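/- Let a > 0, E > 0 and x ∈ ℝ with x ≠ 0. Then the Abel limit of the overlap series between the position eigenvector and the even free-particle energy eigenvector exists and equals lim_{t→1⁻} Σ_{n=0}^{∞} β_{2n}(x)·ε_{2n}(E)·tⁿ = (1/(2^{a/2}·Γ(a))) · |x|^{a−1/2} · E^{(a−1)/2} · ₀F₁(−; a; −E·x²/2). -/

import Mathlib

/-- Pochhammer symbol `(c)_k` in `ℂ`. -/
noncomputable def pochC (c : ℂ) (k : ℕ) : ℂ := ∏ j ∈ Finset.range k, (c + j)

/-- Pochhammer symbol `(c)_k` in `ℝ`. -/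
noncomputable def pochR (c : ℝ) (k : ℕ) : ℝ := ∏ j ∈ Finset.range k, (c + j)

/-- The prefactor `ℬ₀(x) = |x|^{a−1/2}·e^{−x²/2}/√Γ(a)`. -/
noncomputable def calB0 (a x : ℝ) : ℝ :=
  |x| ^ (a - 1 / 2) * Real.exp (-x ^ 2 / 2) / Real.sqrt (Real.Gamma a)

/-- The coefficient `β_{2n}(x) = (−1)ⁿ √((a)_n/n!) ℬ₀(x) ₁F₁(−n; a; x²)`. -/
noncomputable def betaEv (a x : ℝ) (n : ℕ) : ℂ :=
  (-1) ^ n * (Real.sqrt (pochR a n / n.factorial) : ℂ) * (calB0 a x : ℂ) *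
    ∑ k ∈ Finset.range (n + 1),
      pochC (-(n : ℂ)) k / (pochC (a : ℂ) k * (k.factorial : ℂ)) * (x : ℂ) ^ (2 * k)

/-- The prefactor `ℰ₀(E) = E^{(a−1)/2}·e^{−E}·√(2^a)/√Γ(a)`. -/
noncomputable def calE0 (a E : ℝ) : ℝ :=
  E ^ ((a - 1) / 2) * Real.exp (-E) * Real.sqrt ((2 : ℝ) ^ a) / Real.sqrt (Real.Gamma a)

/-- The coefficient `ε_{2n}(E) = √((a)_n/n!)·ℰ₀(E)·₁F₁(−n; a; 2E)`. -/
noncomputable def epsEv (a E : ℝ) (n : ℕ) : ℝ :=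
  Real.sqrt (pochR a n / n.factorial) * calE0 a E *
    ∑ k ∈ Finset.range (n + 1),
      pochR (-(n : ℝ)) k / (pochR a k * k.factorial) * (2 * E) ^ k

/-- The confluent hypergeometric limit function `₀F₁(−; c; z) = Σ z^k/((c)_k·k!)`. -/
noncomputable def hyp0F1 (c z : ℂ) : ℂ := ∑' k : ℕ, z ^ k / (pochC c k * (k.factorial : ℂ))

section DoubleSeries

theorem hasSum_prod_of_dominated {f F : ℕ → ℕ → ℝ} {g G : ℕ → ℝ} {S : ℝ}
    (hle : ∀ j m, |f j m| ≤ F j m) (hF : ∀ j, HasSum (F j) (G j)) (hG : Summable G)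
    (hf : ∀ j, HasSum (f j) (g j)) (hg : HasSum g S) :
    HasSum (fun p : ℕ × ℕ => f p.1 p.2) S := by
  have hF0 : (0 : ℕ × ℕ → ℝ) ≤ fun p => F p.1 p.2 := fun p => (abs_nonneg _).trans (hle _ _)
  have hsF : Summable fun p : ℕ × ℕ => F p.1 p.2 :=
    (summable_prod_of_nonneg hF0).2
      ⟨fun j => (hF j).summable, hG.congr fun j => ((hF j).tsum_eq).symm⟩
  have hsf : Summable fun p : ℕ × ℕ => f p.1 p.2 :=
    Summable.of_norm_bounded hsF fun p => by simpa using hle p.1 p.2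
  have := hsf.hasSum.prod_fiberwise hf
  rw [← this.unique hg]
  exact hsf.hasSum

theorem hasSum_antidiagonal_of_prod {f : ℕ → ℕ → ℝ} {S : ℝ}
    (h : HasSum (fun p : ℕ × ℕ => f p.1 p.2) S) :
    HasSum (fun n => ∑ j ∈ Finset.range (n + 1), f j (n - j)) S := by
  rw [← Finset.HasAntidiagonal.sigmaAntidiagonalEquivProd.hasSum_iff] at h
  have := h.sigma (g := fun n => ∑ j ∈ Finset.range (n + 1), f j (n - j)) fun n => by
    rw [← Finset.Nat.sum_antidiagonal_eq_sum_range_succ f n, ← Finset.sum_coe_sort]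
    exact hasSum_fintype _
  exact this

theorem hasSum_swap_of_prod {f : ℕ → ℕ → ℝ} {r : ℕ → ℝ} {S : ℝ}
    (h : HasSum (fun p : ℕ × ℕ => f p.1 p.2) S) (hr : ∀ m, HasSum (fun j => f j m) (r m)) :
    HasSum r S :=
  ((Equiv.prodComm ℕ ℕ).hasSum_iff.2 h).prod_fiberwise hr

theorem hasSum_of_hasSum_add {f : ℕ → ℝ} {S : ℝ} (l : ℕ) (h0 : ∀ j < l, f j = 0)
    (h : HasSum (fun m => f (m + l)) S) : HasSum f S := by
  rw [hasSum_nat_add_iff, Finset.sum_eq_zero fun j hj => h0 j (Finset.mem_range.1 hj)] at h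
  simpa using h

end DoubleSeries

theorem pochR_pos {b : ℝ} (hb : 0 < b) (m : ℕ) : 0 < pochR b m :=
  Finset.prod_pos fun _ _ => by positivity

theorem pochR_add (b : ℝ) (k m : ℕ) : pochR b (k + m) = pochR b k * pochR (b + k) m := by
  simp only [pochR, Finset.prod_range_add, Nat.cast_add, add_assoc]

theorem pochR_succ (b : ℝ) (k : ℕ) : pochR b (k + 1) = pochR b k * (b + k) := by
  simp [pochR, Finset.prod_range_succ]

theorem pochR_succ_left (b : ℝ) (k : ℕ) : pochR b (k + 1) = b * pochR (b + 1) k := by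
  rw [add_comm k 1, pochR_add]
  simp [pochR]

theorem pochR_eq_ascPochhammer (b : ℝ) (k : ℕ) : pochR b k = (ascPochhammer ℝ k).eval b := by
  induction k with
  | zero => simp [pochR]
  | succ k ih => rw [pochR_succ, ascPochhammer_succ_eval, ih]

/-- The coefficient of `s ^ m` in `(1 - s) ^ (-b)`. -/
noncomputable def riseCoeff (b : ℝ) (m : ℕ) : ℝ := pochR b m / m.factorial

theorem riseCoeff_nonneg {b : ℝ} (hb : 0 < b) (m : ℕ) : 0 ≤ riseCoeff b m :=
  div_nonneg (pochR_pos hb m).le (by positivity)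

theorem riseCoeff_zero (b : ℝ) : riseCoeff b 0 = 1 := by simp [riseCoeff, pochR]

theorem riseCoeff_succ_add_one (b : ℝ) (m : ℕ) :
    riseCoeff (b + 1) (m + 1) = riseCoeff b (m + 1) + riseCoeff (b + 1) m := by
  simp only [riseCoeff, pochR_succ_left b, pochR_succ (b + 1), Nat.factorial_succ]
  have : (m.factorial : ℝ) ≠ 0 := by positivity
  push_cast
  field_simp
  ring

theorem choose_mul_riseCoeff (b : ℝ) (k m : ℕ) :
    ((m + k).choose k : ℝ) * riseCoeff b (m + k) = riseCoeff b k * riseCoeff (b + k) m := by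
  have h : (((m + k).choose k * m.factorial * k.factorial : ℕ) : ℝ) = ((m + k).factorial : ℕ) := by
    rw [← Nat.add_choose_mul_factorial_mul_factorial m]
  push_cast at h
  have h1 : (m.factorial : ℝ) ≠ 0 := by positivity
  have h2 : (k.factorial : ℝ) ≠ 0 := by positivity
  have h3 : ((m + k).factorial : ℝ) ≠ 0 := by positivity
  simp only [riseCoeff]
  rw [add_comm m k, pochR_add, add_comm k m]
  field_simp
  linear_combination pochR b k * pochR (b + k) m * h

theorem hasSum_riseCoeff (b : ℝ) {s : ℝ} (hs : |s| < 1) :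
    HasSum (fun m => riseCoeff b m * s ^ m) ((1 - s) ^ (-b)) := by
  have h := (Real.one_div_one_sub_rpow_hasFPowerSeriesOnBall_zero b).hasSum (y := s)
    (by simpa [enorm_eq_nnnorm, ← NNReal.coe_lt_coe] using hs)
  simp only [FormalMultilinearSeries.ofScalars_apply_eq, zero_add] at h
  rw [Real.rpow_neg (by linarith [(abs_lt.1 hs).2]), ← one_div]
  convert! h using 1
  funext m
  have hm := Ring.factorial_nsmul_multichoose_eq_ascPochhammer b m
  rw [Polynomial.ascPochhammer_smeval_eq_eval, nsmul_eq_mul, ← pochR_eq_ascPochhammer] at hm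
  have h1 : (m.factorial : ℝ) ≠ 0 := by positivity
  rw [Ring.choose, riseCoeff, ← hm, show b + m - 1 - m + 1 = b by ring]
  simp [h1, mul_comm]

theorem hasSum_choose_riseCoeff (b : ℝ) (k : ℕ) {s : ℝ} (hs : |s| < 1) :
    HasSum (fun m => (m.choose k : ℝ) * riseCoeff b m * s ^ m)
      (s ^ k * riseCoeff b k * ((1 - s) ^ (-b) / (1 - s) ^ k)) := by
  have h1 : 0 < 1 - s := by linarith [(abs_lt.1 hs).2]
  refine hasSum_of_hasSum_add k (fun j hj => by simp [Nat.choose_eq_zero_of_lt hj]) ?_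
  have h := (hasSum_riseCoeff (b + k) hs).mul_left (s ^ k * riseCoeff b k)
  rw [neg_add, ← sub_eq_add_neg, Real.rpow_sub h1, Real.rpow_natCast] at h
  convert! h using 1
  funext m
  rw [choose_mul_riseCoeff]
  ring

theorem hasSum_choose_mul_exp (z : ℝ) (l : ℕ) :
    HasSum (fun j => (j.choose l : ℝ) * (z ^ j / j.factorial))
      (z ^ l / l.factorial * Real.exp z) := by
  refine hasSum_of_hasSum_add l (fun j hj => by simp [Nat.choose_eq_zero_of_lt hj]) ?_
  have h := (NormedSpace.expSeries_div_hasSum_exp z).mul_left (z ^ l / l.factorial)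
  rw [← Real.exp_eq_exp_ℝ] at h
  convert! h using 1
  funext m
  have h : (((m + l).choose l * m.factorial * l.factorial : ℕ) : ℝ) = ((m + l).factorial : ℕ) := by
    rw [← Nat.add_choose_mul_factorial_mul_factorial m]
  push_cast at h
  have h1 : (m.factorial : ℝ) ≠ 0 := by positivity
  have h2 : (l.factorial : ℝ) ≠ 0 := by positivity
  have h3 : ((m + l).factorial : ℝ) ≠ 0 := by positivity
  field_simp
  linear_combination z ^ (m + l) * h

/-- The polynomial `[zᵏ] (1 - s z) ^ (-a - j) (1 + (1 - s) z) ^ j` in `s`. -/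
noncomputable def vanderPoly (a s : ℝ) (j k : ℕ) : ℝ :=
  ∑ l ∈ Finset.range (k + 1), (j.choose l : ℝ) * (s ^ (k - l) * riseCoeff (a + l) (k - l))

theorem vanderPoly_zero_left (a s : ℝ) (k : ℕ) : vanderPoly a s 0 k = s ^ k * riseCoeff a k := by
  rw [vanderPoly, Finset.sum_range_succ']
  simp

theorem vanderPoly_zero_right (a s : ℝ) (j : ℕ) : vanderPoly a s j 0 = 1 := by
  simp [vanderPoly, riseCoeff_zero]

theorem vanderPoly_succ_succ (a s : ℝ) (j k : ℕ) :
    vanderPoly a s (j + 1) (k + 1) = vanderPoly a s j (k + 1) + vanderPoly (a + 1) s j k := by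
  simp only [vanderPoly]
  rw [Finset.sum_range_succ', Finset.sum_range_succ' _ (k + 1), add_right_comm,
    ← Finset.sum_add_distrib]
  congr 1
  · refine Finset.sum_congr rfl fun l _ => ?_
    rw [Nat.choose_succ_succ, Nat.add_sub_add_right, show a + ((l + 1 : ℕ) : ℝ) = a + 1 + l by
      push_cast; ring]
    push_cast
    ring
  · simp

theorem vanderPoly_add_one (a s : ℝ) (j k : ℕ) :
    vanderPoly (a + 1) s j (k + 1) = vanderPoly a s j (k + 1) + s * vanderPoly (a + 1) s j k := by
  simp only [vanderPoly]
  rw [Finset.sum_range_succ, Finset.sum_range_succ _ (k + 1), add_right_comm _ _ (s * _), Finset.mul_sum,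
    ← Finset.sum_add_distrib]
  congr 1
  · refine Finset.sum_congr rfl fun l hl => ?_
    rw [Nat.succ_sub (Finset.mem_range_succ_iff.1 hl), Nat.succ_eq_add_one, add_right_comm,
      riseCoeff_succ_add_one]
    ring
  · simp [riseCoeff_zero]

theorem hasSum_choose_add_riseCoeff {s : ℝ} (hs : |s| < 1) (j : ℕ) : ∀ (a : ℝ) (k : ℕ),
    HasSum (fun m => ((j + m).choose k : ℝ) * riseCoeff (a + j) m * s ^ m)
      ((1 - s) ^ (-a) / (1 - s) ^ (k + j) * vanderPoly a s j k) := by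
  have h1 : 0 < 1 - s := by linarith [(abs_lt.1 hs).2]
  have hp (a : ℝ) : (1 - s) ^ (-(a + 1)) = (1 - s) ^ (-a) / (1 - s) := by
    rw [neg_add, ← sub_eq_add_neg, Real.rpow_sub h1, Real.rpow_one]
  induction j with
  | zero =>
    intro a k
    convert! hasSum_choose_riseCoeff a k hs using 1
    · simp
    · rw [vanderPoly_zero_left, add_zero, mul_comm]
  | succ j ih =>
    intro a k
    have hc : a + ((j + 1 : ℕ) : ℝ) = a + 1 + j := by push_cast; ring
    rw [hc]
    cases k with
    | zero =>
      convert! ih (a + 1) 0 using 1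
      · simp
      · rw [vanderPoly_zero_right, vanderPoly_zero_right, hp]
        field_simp
        ring
    | succ k =>
      convert! (ih (a + 1) k).add (ih (a + 1) (k + 1)) using 1
      · funext m
        rw [show j + 1 + m = j + m + 1 by ring, Nat.choose_succ_succ]
        push_cast
        ring
      · rw [vanderPoly_succ_succ, vanderPoly_add_one, hp]
        field_simp
        ring

/-- The Laguerre polynomial `L_n^{(a-1)}(-y)`. -/
noncomputable def lagNeg (a y : ℝ) (n : ℕ) : ℝ :=
  ∑ j ∈ Finset.range (n + 1), riseCoeff (a + j) (n - j) * (y ^ j / j.factorial)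

theorem abs_lagNeg_le {a : ℝ} (ha : 0 < a) (y : ℝ) (n : ℕ) : |lagNeg a y n| ≤ lagNeg a |y| n := by
  refine (Finset.abs_sum_le_sum_abs _ _).trans (Finset.sum_le_sum fun j _ => le_of_eq ?_)
  rw [abs_mul, abs_div, abs_pow, Nat.abs_cast, abs_of_nonneg (riseCoeff_nonneg (by positivity) _)]

theorem hasSum_vanderPoly_mul_exp (a s y : ℝ) (hs : s ≠ 1) (k : ℕ) :
    HasSum (fun j => y ^ j / j.factorial * s ^ j *
        ((1 - s) ^ (-a) / (1 - s) ^ (k + j) * vanderPoly a s j k))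
      (s ^ k * ((1 - s) ^ (-a) / (1 - s) ^ k) * Real.exp (s * (y / (1 - s))) *
        lagNeg a (y / (1 - s)) k) := by
  have h1 : 1 - s ≠ 0 := sub_ne_zero.2 hs.symm
  have h := hasSum_sum (s := Finset.range (k + 1)) fun l _ =>
    (hasSum_choose_mul_exp (s * (y / (1 - s))) l).mul_left
      ((1 - s) ^ (-a) / (1 - s) ^ k * (s ^ (k - l) * riseCoeff (a + l) (k - l)))
  convert! h using 1
  · funext j
    rw [vanderPoly, Finset.mul_sum, Finset.mul_sum]
    refine Finset.sum_congr rfl fun l _ => ?_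
    rw [mul_pow, div_pow]
    field_simp
    ring
  · rw [lagNeg, Finset.mul_sum]
    refine Finset.sum_congr rfl fun l hl => ?_
    rw [← pow_sub_mul_pow s (Finset.mem_range_succ_iff.1 hl)]
    ring

/-- The generating function of `C(n, k) L_n^{(a-1)}`. -/
theorem hasSum_choose_lagNeg {a s : ℝ} (ha : 0 < a) (hs : |s| < 1) (y : ℝ) (k : ℕ) :
    HasSum (fun n => (n.choose k : ℝ) * lagNeg a y n * s ^ n)
      (s ^ k * ((1 - s) ^ (-a) / (1 - s) ^ k) * Real.exp (s * (y / (1 - s))) *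
        lagNeg a (y / (1 - s)) k) := by
  have inner (s y : ℝ) (hs : |s| < 1) (j : ℕ) :=
    (hasSum_choose_add_riseCoeff hs j a k).mul_left (y ^ j / j.factorial * s ^ j)
  have hs' : |(|s|)| < 1 := by rwa [abs_abs]
  have h := hasSum_antidiagonal_of_prod <| hasSum_prod_of_dominated
    (fun j m => le_of_eq (by
      simp only [abs_mul, abs_div, abs_pow, Nat.abs_cast]
      rw [abs_of_nonneg (riseCoeff_nonneg (by positivity : 0 < a + j) m)]))
    (inner |s| |y| hs') (hasSum_vanderPoly_mul_exp a |s| |y| hs.ne k).summable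
    (inner s y hs) (hasSum_vanderPoly_mul_exp a s y (abs_lt.1 hs).2.ne k)
  convert! h using 1
  funext n
  rw [lagNeg, Finset.mul_sum, Finset.sum_mul]
  refine Finset.sum_congr rfl fun j hj => ?_
  have hj := Finset.mem_range_succ_iff.1 hj
  rw [Nat.add_sub_cancel' hj, ← pow_mul_pow_sub s hj]
  ring

theorem pow_le_pochR {a : ℝ} (ha : 0 < a) (k : ℕ) : a ^ k ≤ pochR a k := by
  simpa [pochR] using Finset.prod_le_prod (s := Finset.range k) (f := fun _ : ℕ => a)
    (g := fun j : ℕ => a + (j : ℝ)) (fun _ _ => ha.le) (fun j _ => by simp)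

theorem abs_hyp_term_le {a : ℝ} (ha : 0 < a) (z : ℝ) (k : ℕ) :
    |z ^ k / (pochR a k * k.factorial)| ≤ (|z| / a) ^ k / k.factorial := by
  rw [abs_div, abs_pow, abs_mul, Nat.abs_cast, abs_of_pos (pochR_pos ha k), div_pow, div_div]
  have := pow_le_pochR ha k
  gcongr

theorem summable_hyp {a : ℝ} (ha : 0 < a) (z : ℝ) :
    Summable fun k : ℕ => z ^ k / (pochR a k * k.factorial) :=
  Summable.of_norm_bounded (Real.summable_pow_div_factorial (|z| / a)) fun k => abs_hyp_term_le ha z k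

/-- The real confluent hypergeometric limit function `₀F₁(−; a; z)`. -/
noncomputable def hyp0F1R (a z : ℝ) : ℝ := ∑' k : ℕ, z ^ k / (pochR a k * k.factorial)

theorem hasSum_lagNeg_div_pochR {a : ℝ} (ha : 0 < a) (u y : ℝ) :
    HasSum (fun k => u ^ k / pochR a k * lagNeg a y k) (hyp0F1R a (u * y) * Real.exp u) := by
  have inner (u y : ℝ) (j : ℕ) : HasSum (fun m : ℕ => (u * y) ^ j / (pochR a j * j.factorial) *
      (u ^ m / m.factorial)) ((u * y) ^ j / (pochR a j * j.factorial) * Real.exp u) := by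
    rw [Real.exp_eq_exp_ℝ]
    exact (NormedSpace.expSeries_div_hasSum_exp u).mul_left _
  have h := hasSum_antidiagonal_of_prod <| hasSum_prod_of_dominated
    (fun j m => le_of_eq (by
      simp only [abs_mul, abs_div, abs_pow, Nat.abs_cast]
      rw [abs_of_pos (pochR_pos ha j)]))
    (inner |u| |y|) ((summable_hyp ha _).mul_right _)
    (inner u y) ((summable_hyp ha _).hasSum.mul_right _)
  convert! h using 1
  funext n
  rw [lagNeg, Finset.mul_sum]
  refine Finset.sum_congr rfl fun j hj => ?_
  obtain ⟨m, rfl⟩ := Nat.exists_eq_add_of_le (Finset.mem_range_succ_iff.1 hj)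
  have h1 := (pochR_pos ha j).ne'
  have h2 := (pochR_pos (by positivity : 0 < a + j) m).ne'
  rw [Nat.add_sub_cancel_left, riseCoeff, pochR_add]
  field_simp
  ring

/-- The Hardy–Hille formula for Laguerre polynomials. -/
theorem hardy_hille {a s : ℝ} (ha : 0 < a) (hs : |s| < 1) (y w : ℝ) :
    HasSum (fun n => lagNeg a y n * s ^ n *
        ∑ k ∈ Finset.range (n + 1), (n.choose k : ℝ) * (w ^ k / pochR a k))
      ((1 - s) ^ (-a) * Real.exp (s * (y / (1 - s))) *
        (hyp0F1R a (w * s / (1 - s) * (y / (1 - s))) * Real.exp (w * s / (1 - s)))) := by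
  have inner (s y w : ℝ) (hs : |s| < 1) (k : ℕ) :=
    (hasSum_choose_lagNeg ha hs y k).mul_left (w ^ k / pochR a k)
  have outer (s y w : ℝ) (hs : s ≠ 1) :
      HasSum (fun k => w ^ k / pochR a k * (s ^ k * ((1 - s) ^ (-a) / (1 - s) ^ k) *
        Real.exp (s * (y / (1 - s))) * lagNeg a (y / (1 - s)) k))
      ((1 - s) ^ (-a) * Real.exp (s * (y / (1 - s))) *
        (hyp0F1R a (w * s / (1 - s) * (y / (1 - s))) * Real.exp (w * s / (1 - s)))) := by
    have h1 : 1 - s ≠ 0 := sub_ne_zero.2 hs.symm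
    convert! (hasSum_lagNeg_div_pochR ha (w * s / (1 - s)) (y / (1 - s))).mul_left
      ((1 - s) ^ (-a) * Real.exp (s * (y / (1 - s)))) using 1
    funext k
    rw [div_pow, mul_pow]
    ring
  have hs' : |(|s|)| < 1 := by rwa [abs_abs]
  refine hasSum_swap_of_prod (hasSum_prod_of_dominated
    (fun k n => ?_) (inner |s| |y| |w| hs') (outer |s| |y| |w| hs.ne).summable
    (inner s y w hs) (outer s y w (abs_lt.1 hs).2.ne)) fun n => ?_
  · have := abs_lagNeg_le ha y n
    have h1 := pochR_pos ha k
    simp only [abs_mul, abs_div, abs_pow, Nat.abs_cast, abs_of_pos h1]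
    gcongr
  · have h := hasSum_sum_of_ne_finset_zero (s := Finset.range (n + 1))
      (L := SummationFilter.unconditional ℕ)
      (f := fun k => w ^ k / pochR a k * ((n.choose k : ℝ) * lagNeg a y n * s ^ n))
      fun k hk => by
        rw [Nat.choose_eq_zero_of_lt (by simpa [Nat.lt_succ_iff] using hk)]
        simp
    convert! h using 1
    rw [Finset.mul_sum]
    refine Finset.sum_congr rfl fun k _ => ?_
    ring

theorem continuous_hyp0F1R {a : ℝ} (ha : 0 < a) : Continuous (hyp0F1R a) := by
  refine continuous_iff_continuousAt.2 fun z => ?_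
  refine ContinuousOn.continuousAt (s := Metric.ball 0 (|z| + 1)) ?_
    (Metric.isOpen_ball.mem_nhds (by simp))
  refine continuousOn_tsum (fun k => by fun_prop)
    (Real.summable_pow_div_factorial ((|z| + 1) / a)) fun k w hw => ?_
  have hw : |w| ≤ |z| + 1 := by simpa using (Metric.mem_ball.1 hw).le
  refine (abs_hyp_term_le ha w k).trans ?_
  gcongr

theorem pochC_ofReal (b : ℝ) (k : ℕ) : pochC (b : ℂ) k = (pochR b k : ℂ) := by
  simp [pochC, pochR]

theorem hyp0F1_ofReal (a z : ℝ) : hyp0F1 (a : ℂ) (z : ℂ) = (hyp0F1R a z : ℂ) := by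
  rw [hyp0F1, hyp0F1R, Complex.ofReal_tsum]
  simp [pochC_ofReal]

theorem pochR_neg_natCast (n k : ℕ) :
    pochR (-(n : ℝ)) k = (-1) ^ k * k.factorial * n.choose k := by
  induction k with
  | zero => simp [pochR]
  | succ k ih =>
    have h : (n.choose (k + 1) : ℝ) * (k + 1) = n.choose k * (n - k) := by
      rcases le_or_gt k n with hk | hk
      · rw [← Nat.cast_sub hk]
        exact_mod_cast Nat.choose_succ_right_eq n k
      · simp [Nat.choose_eq_zero_of_lt hk, Nat.choose_eq_zero_of_lt (hk.trans k.lt_succ_self)]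
    rw [pochR_succ, ih, Nat.factorial_succ]
    push_cast
    linear_combination (-1) ^ k * (k.factorial : ℝ) * h

theorem sum_pochR_neg_natCast (a z : ℝ) (n : ℕ) :
    ∑ k ∈ Finset.range (n + 1), pochR (-(n : ℝ)) k / (pochR a k * k.factorial) * z ^ k =
      ∑ k ∈ Finset.range (n + 1), (n.choose k : ℝ) * ((-z) ^ k / pochR a k) := by
  refine Finset.sum_congr rfl fun k _ => ?_
  have : (k.factorial : ℝ) ≠ 0 := by positivity
  rw [pochR_neg_natCast, neg_pow z]
  field_simp

theorem riseCoeff_mul_sum_choose {a : ℝ} (ha : 0 < a) (y : ℝ) (n : ℕ) :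
    riseCoeff a n * ∑ k ∈ Finset.range (n + 1), (n.choose k : ℝ) * (y ^ k / pochR a k) =
      lagNeg a y n := by
  rw [lagNeg, Finset.mul_sum]
  refine Finset.sum_congr rfl fun k hk => ?_
  obtain ⟨m, rfl⟩ := Nat.exists_eq_add_of_le' (Finset.mem_range_succ_iff.1 hk)
  have := (pochR_pos ha k).ne'
  have h := choose_mul_riseCoeff a k m
  rw [Nat.add_sub_cancel]
  calc riseCoeff a (m + k) * (((m + k).choose k : ℝ) * (y ^ k / pochR a k))
      = ((m + k).choose k : ℝ) * riseCoeff a (m + k) * (y ^ k / pochR a k) := by ring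
    _ = _ := by
      rw [h, riseCoeff]
      field_simp

theorem betaEv_eq (a x : ℝ) (n : ℕ) :
    betaEv a x n = (((-1) ^ n * Real.sqrt (riseCoeff a n) * calB0 a x *
      ∑ k ∈ Finset.range (n + 1), (n.choose k : ℝ) * ((-x ^ 2) ^ k / pochR a k) : ℝ) : ℂ) := by
  rw [← sum_pochR_neg_natCast, betaEv, riseCoeff]
  simp [← pochC_ofReal, pow_mul]

theorem betaEv_mul_epsEv {a : ℝ} (ha : 0 < a) (E x t : ℝ) (n : ℕ) :
    betaEv a x n * (epsEv a E n : ℂ) * (t : ℂ) ^ n =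
      ((calB0 a x * calE0 a E * (lagNeg a (-x ^ 2) n * (-t) ^ n *
        ∑ k ∈ Finset.range (n + 1), (n.choose k : ℝ) * ((-(2 * E)) ^ k / pochR a k)) : ℝ) : ℂ) := by
  have h := Real.mul_self_sqrt (riseCoeff_nonneg ha n)
  rw [betaEv_eq, epsEv, sum_pochR_neg_natCast, ← riseCoeff_mul_sum_choose ha, neg_pow t,
    ← riseCoeff, ← Complex.ofReal_pow, ← Complex.ofReal_mul, ← Complex.ofReal_mul]
  congr 1
  generalize ∑ k ∈ Finset.range (n + 1), (n.choose k : ℝ) * ((-x ^ 2) ^ k / pochR a k) = A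
  generalize ∑ k ∈ Finset.range (n + 1), (n.choose k : ℝ) * ((-(2 * E)) ^ k / pochR a k) = B
  linear_combination (-1) ^ n * calB0 a x * A * calE0 a E * B * t ^ n * h

theorem calB0_mul_calE0_mul {a : ℝ} (ha : 0 < a) (E x H : ℝ) :
    calB0 a x * calE0 a E * ((2 : ℝ) ^ (-a) * Real.exp (x ^ 2 / 2) * (H * Real.exp E)) =
      1 / ((2 : ℝ) ^ (a / 2) * Real.Gamma a) * |x| ^ (a - 1 / 2) * E ^ ((a - 1) / 2) * H := by
  have hG := Real.Gamma_pos_of_pos ha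
  have hs : Real.sqrt (Real.Gamma a) ≠ 0 := (Real.sqrt_pos.2 hG).ne'
  have h2 : Real.sqrt ((2 : ℝ) ^ a) = 2 ^ (a / 2) := by
    rw [Real.sqrt_eq_rpow, ← Real.rpow_mul (by norm_num)]
    ring_nf
  have h3 : (2 : ℝ) ^ (-a) = ((2 : ℝ) ^ (a / 2))⁻¹ * ((2 : ℝ) ^ (a / 2))⁻¹ := by
    rw [← mul_inv, ← Real.rpow_add (by norm_num), add_halves, Real.rpow_neg (by norm_num)]
  have h4 : (2 : ℝ) ^ (a / 2) ≠ 0 := by positivity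
  rw [calB0, calE0, h2, h3, neg_div, Real.exp_neg, Real.exp_neg]
  field_simp
  rw [Real.sq_sqrt hG.le]
  ring

/-- the Abel limit of the overlap series between the position eigenvector
and the even free-particle energy eigenvector exists and equals
`(1/(2^{a/2}·Γ(a))) · |x|^{a−1/2} · E^{(a−1)/2} · ₀F₁(−; a; −E·x²/2)`. -/
theorem abel_limit_position_even_free (a E x : ℝ) (ha : 0 < a) (hE : 0 < E) (hx : x ≠ 0) :
    Filter.Tendsto
      (fun t : ℝ => ∑' n : ℕ, betaEv a x n * (epsEv a E n : ℂ) * (t : ℂ) ^ n)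
      (nhdsWithin 1 (Set.Iio 1))
      (nhds
        ((1 / (((2 : ℝ) ^ (a / 2) * Real.Gamma a : ℝ) : ℂ)) *
          ((|x| ^ (a - 1 / 2) : ℝ) : ℂ) * ((E ^ ((a - 1) / 2) : ℝ) : ℂ) *
          hyp0F1 (a : ℂ) (-(E : ℂ) * (x : ℂ) ^ 2 / 2))) := by
  have hφ : ContinuousAt (fun t : ℝ => calB0 a x * calE0 a E *
      ((1 - -t) ^ (-a) * Real.exp (-t * (-x ^ 2 / (1 - -t))) *
        (hyp0F1R a (-(2 * E) * -t / (1 - -t) * (-x ^ 2 / (1 - -t))) *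
          Real.exp (-(2 * E) * -t / (1 - -t))))) 1 := by
    have h2 : (1 : ℝ) - -1 ≠ 0 := by norm_num
    have hd : ContinuousAt (fun t : ℝ => 1 - -t) 1 := by fun_prop
    have hu : ContinuousAt (fun t : ℝ => -(2 * E) * -t / (1 - -t)) 1 := by
      fun_prop (disch := exact h2)
    have hv : ContinuousAt (fun t : ℝ => -x ^ 2 / (1 - -t)) 1 := by fun_prop (disch := exact h2)
    have hsv : ContinuousAt (fun t : ℝ => -t * (-x ^ 2 / (1 - -t))) 1 :=
      continuousAt_id.neg.mul hv
    exact continuousAt_const.mul (((hd.rpow_const (Or.inl h2)).mul hsv.rexp).mul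
      (((continuous_hyp0F1R ha).continuousAt.comp (hu.mul hv)).mul hu.rexp))
  have hlim := (Complex.continuous_ofReal.continuousAt.tendsto.comp hφ.tendsto).mono_left
    (nhdsWithin_le_nhds (s := Set.Iio 1))
  have hval : calB0 a x * calE0 a E *
      ((1 - -1) ^ (-a) * Real.exp (-1 * (-x ^ 2 / (1 - -1))) *
        (hyp0F1R a (-(2 * E) * -1 / (1 - -1) * (-x ^ 2 / (1 - -1))) *
          Real.exp (-(2 * E) * -1 / (1 - -1)))) =
      1 / ((2 : ℝ) ^ (a / 2) * Real.Gamma a) * |x| ^ (a - 1 / 2) * E ^ ((a - 1) / 2) *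
        hyp0F1R a (-E * x ^ 2 / 2) := by
    rw [← calB0_mul_calE0_mul ha]
    ring_nf
  rw [hval] at hlim
  have hz : -(E : ℂ) * (x : ℂ) ^ 2 / 2 = ((-E * x ^ 2 / 2 : ℝ) : ℂ) := by push_cast; ring
  rw [hz, hyp0F1_ofReal, ← Complex.ofReal_one, ← Complex.ofReal_div, ← Complex.ofReal_mul,
    ← Complex.ofReal_mul, ← Complex.ofReal_mul]
  refine hlim.congr' ?_
  filter_upwards [Ioo_mem_nhdsLT (show (0 : ℝ) < 1 by norm_num)] with t ht
  have ht' : |(-t)| < 1 := by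
    rw [abs_neg, abs_of_pos ht.1]
    exact ht.2
  simp only [betaEv_mul_epsEv ha, Function.comp_apply]
  rw [← Complex.ofReal_tsum,
    ((hardy_hille ha ht' (-x ^ 2) (-(2 * E))).mul_left (calB0 a x * calE0 a E)).tsum_eq]
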